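/- Let R be a commutative Noetherian ring, (x, y) a pair of exact zero-divisors on R, and M an R-module with M ≠ xM and x ∉ (0 :_R M). Write R̄ = R/(x) and M̄ = M/xM. Assume at least one of id_R M, pd_R M, fd_R M is finite. Then: (a) (x, y) is a pair of exact zero-divisors on M; (b) correspondingly, id_{R̄} M̄ ≤ id_R M, pd_{R̄} M̄ ≤ pd_R M, or fd_{R̄} M̄ ≤ fd_R M; (c) if R is local and M is finitely generated, then each inequality in (b) that applies is an equality. -/

import Mathlib

/-- `(x, y)` is a pair of exact zero-divisors on the `R`-module `M`:
`M ≠ xM`, `x ∉ (0 :_R M)`, `(0 :_M x) = yM` and `(0 :_M y) = xM`. -/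
def IsEZDPair (R : Type*) [CommRing R] (M : Type*) [AddCommGroup M] [Module R M]
    (x y : R) : Prop :=
  Ideal.span {x} • (⊤ : Submodule R M) ≠ ⊤ ∧
  (∃ m : M, x • m ≠ 0) ∧
  Submodule.torsionBy R M x = Ideal.span {y} • (⊤ : Submodule R M) ∧
  Submodule.torsionBy R M y = Ideal.span {x} • (⊤ : Submodule R M)

/-- `x 0, …, x (n-1)` is a sequence of exact zero-divisors on `M` with twins
`y 0, …, y (n-1)`: each `(x i, y i)` is a pair of exact zero-divisors on
`M ⧸ (x 0, …, x (i-1))M`. -/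
def IsEZDSeqWithTwins (R : Type*) [CommRing R] (M : Type*) [AddCommGroup M] [Module R M]
    {n : ℕ} (x y : Fin n → R) : Prop :=
  ∀ i : Fin n,
    IsEZDPair R (M ⧸ (Ideal.span (x '' {j | j < i}) • (⊤ : Submodule R M))) (x i) (y i)

/-- `x 0, …, x (n-1)` is a sequence of exact zero-divisors on `M`. -/
def IsEZDSeq (R : Type*) [CommRing R] (M : Type*) [AddCommGroup M] [Module R M]
    {n : ℕ} (x : Fin n → R) : Prop :=
  ∀ i : Fin n, ∃ y : R,
    IsEZDPair R (M ⧸ (Ideal.span (x '' {j | j < i}) • (⊤ : Submodule R M))) (x i) y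

universe u

open CategoryTheory in
/-- `Ext^i_R(M, N)` as an `R`-module. -/
noncomputable def extRMod (R : Type u) [CommRing R] (M N : ModuleCat.{u} R) (i : ℕ) :
    ModuleCat.{u} R :=
  ((Ext R (ModuleCat.{u} R) i).obj (Opposite.op M)).obj N

open CategoryTheory in
/-- `Tor_i^R(M, N)` as an `R`-module. -/
noncomputable def torRMod (R : Type u) [CommRing R] (M N : ModuleCat.{u} R) (i : ℕ) :
    ModuleCat.{u} R :=
  ((Tor (ModuleCat.{u} R) i).obj M).obj N

/-- The projective dimension of an `R`-module `M`, characterized via vanishing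
of `Ext^i(M, -)` for `i > d`. -/
noncomputable def projDim (R : Type u) [CommRing R] (M : ModuleCat.{u} R) : ℕ∞ :=
  sInf {d : ℕ∞ | ∀ (N : ModuleCat.{u} R) (i : ℕ), d < (i : ℕ∞) →
    Subsingleton (extRMod R M N i)}

/-- The injective dimension of an `R`-module `M`, characterized via vanishing
of `Ext^i(-, M)` for `i > d`. -/
noncomputable def injDim (R : Type u) [CommRing R] (M : ModuleCat.{u} R) : ℕ∞ :=
  sInf {d : ℕ∞ | ∀ (N : ModuleCat.{u} R) (i : ℕ), d < (i : ℕ∞) →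
    Subsingleton (extRMod R N M i)}

/-- The flat dimension of an `R`-module `M`, characterized via vanishing
of `Tor_i(-, M)` for `i > d`. -/
noncomputable def flatDim (R : Type u) [CommRing R] (M : ModuleCat.{u} R) : ℕ∞ :=
  sInf {d : ℕ∞ | ∀ (N : ModuleCat.{u} R) (i : ℕ), d < (i : ℕ∞) →
    Subsingleton (torRMod R N M i)}

section

open CategoryTheory

section Bridge

variable {R : Type u} [CommRing R]

lemma subsingleton_extRMod_succ_iff (M N : ModuleCat.{u} R) (n : ℕ) :
    Subsingleton (extRMod R M N (n + 1)) ↔ Subsingleton (Abelian.Ext M N (n + 1)) := by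
  let P := projectiveResolution M
  have h₁ : Subsingleton (extRMod R M N (n + 1)) ↔
      ∀ f : P.complex.X (n + 1) ⟶ N, P.complex.d (n + 2) (n + 1) ≫ f = 0 →
        ∃ g : P.complex.X n ⟶ N, P.complex.d (n + 1) n ≫ g = f := by
    rw [← ModuleCat.isZero_iff_subsingleton, extRMod, (P.isoExt (n + 1) N).isZero_iff,
      ← HomologicalComplex.exactAt_iff_isZero_homology,
      HomologicalComplex.exactAt_iff' _ n (n + 1) (n + 2) (by simp) (by simp),
      ShortComplex.moduleCat_exact_iff]
    exact Iff.rfl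
  rw [h₁]
  constructor
  · refine fun h ↦ subsingleton_of_forall_eq 0 fun e ↦ ?_
    obtain ⟨f, hf, rfl⟩ := P.extMk_surjective e (n + 2) rfl
    exact (P.extMk_eq_zero_iff f (n + 2) rfl hf n rfl).2 (h f hf)
  · intro h f hf
    exact (P.extMk_eq_zero_iff f (n + 2) rfl hf n rfl).1 (Subsingleton.elim _ _)

lemma exact_iff_forall_characterModule {R A B C : Type*} [CommRing R] [AddCommGroup A]
    [Module R A] [AddCommGroup B] [Module R B] [AddCommGroup C] [Module R C]
    {f : A →ₗ[R] B} {g : B →ₗ[R] C} (hfg : g ∘ₗ f = 0) :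
    Function.Exact f g ↔ ∀ c : CharacterModule B, CharacterModule.dual f c = 0 →
      ∃ d : CharacterModule C, CharacterModule.dual g d = c := by
  constructor
  · intro h c hc
    have hker : ∀ b ∈ (LinearMap.ker g).toAddSubgroup, c b = 0 := by
      intro b hb
      obtain ⟨a, rfl⟩ := (h b).1 hb
      exact DFunLike.congr_fun hc a
    have hinj : Function.Injective ((LinearMap.ker g).liftQ g le_rfl) := by
      rw [← LinearMap.ker_eq_bot]
      exact Submodule.ker_liftQ_eq_bot _ _ _ le_rfl
    obtain ⟨d, hd⟩ := CharacterModule.dual_surjective_of_injective _ hinj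
      (QuotientAddGroup.lift (LinearMap.ker g).toAddSubgroup c hker)
    exact ⟨d, CharacterModule.ext _ fun b ↦ DFunLike.congr_fun hd (Submodule.Quotient.mk b)⟩
  · intro h b
    constructor
    · intro hb
      by_contra hb'
      have hne : (Submodule.Quotient.mk b : B ⧸ LinearMap.range f) ≠ 0 := by
        rwa [ne_eq, Submodule.Quotient.mk_eq_zero]
      obtain ⟨χ, hχ⟩ := CharacterModule.exists_character_apply_ne_zero_of_ne_zero hne
      obtain ⟨d, hd⟩ := h (CharacterModule.dual (LinearMap.range f).mkQ χ) (by
        ext a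
        have : (LinearMap.range f).mkQ (f a) = 0 := by simp
        change χ ((LinearMap.range f).mkQ (f a)) = 0
        rw [this, map_zero])
      apply hχ
      have h₁ : d (g b) = χ (Submodule.Quotient.mk b) := DFunLike.congr_fun hd b
      rw [← h₁, hb, map_zero]
    · rintro ⟨a, rfl⟩
      exact LinearMap.congr_fun hfg a

lemma rTensor_exact_iff_forall_linearMap {R A B C : Type*} (N : Type*) [CommRing R]
    [AddCommGroup A] [Module R A] [AddCommGroup B] [Module R B] [AddCommGroup C] [Module R C]
    [AddCommGroup N] [Module R N] {f : A →ₗ[R] B} {g : B →ₗ[R] C} (hfg : g ∘ₗ f = 0) :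
    Function.Exact (f.rTensor N) (g.rTensor N) ↔
      ∀ u : B →ₗ[R] CharacterModule N, u ∘ₗ f = 0 →
        ∃ v : C →ₗ[R] CharacterModule N, v ∘ₗ g = u := by
  rw [exact_iff_forall_characterModule (by rw [← LinearMap.rTensor_comp, hfg,
    LinearMap.rTensor_zero])]
  have hf (u : B →ₗ[R] CharacterModule N) : CharacterModule.dual (f.rTensor N)
      (CharacterModule.homEquiv u) = CharacterModule.homEquiv (u ∘ₗ f) := by
    rw [← LinearEquiv.symm_apply_eq]; rfl
  have hg (v : C →ₗ[R] CharacterModule N) : CharacterModule.dual (g.rTensor N)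
      (CharacterModule.homEquiv v) = CharacterModule.homEquiv (v ∘ₗ g) := by
    rw [← LinearEquiv.symm_apply_eq]; rfl
  rw [← CharacterModule.homEquiv.forall_congr_right]
  refine forall_congr' fun u ↦ ?_
  change CharacterModule.dual (f.rTensor N) (CharacterModule.homEquiv u) = 0 →
    (∃ d, CharacterModule.dual (g.rTensor N) d = CharacterModule.homEquiv u) ↔ _
  rw [hf, LinearEquiv.map_eq_zero_iff, ← CharacterModule.homEquiv.toEquiv.exists_congr_right]
  refine imp_congr_right fun _ ↦ exists_congr fun v ↦ ?_
  change CharacterModule.dual (g.rTensor N) (CharacterModule.homEquiv v) = _ ↔ _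
  rw [hg, EmbeddingLike.apply_eq_iff_eq]

lemma subsingleton_torRMod_succ_iff (N M : ModuleCat.{u} R) (n : ℕ) :
    Subsingleton (torRMod R N M (n + 1)) ↔
      Subsingleton (Abelian.Ext M (ModuleCat.of R (CharacterModule N)) (n + 1)) := by
  let P := projectiveResolution M
  have h₁ : Subsingleton (torRMod R N M (n + 1)) ↔
      Function.Exact ((P.complex.d (n + 2) (n + 1)).hom.lTensor N)
        ((P.complex.d (n + 1) n).hom.lTensor N) := by
    rw [← ModuleCat.isZero_iff_subsingleton, torRMod, Tor]
    dsimp only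
    rw [(P.isoLeftDerivedObj _ (n + 1)).isZero_iff]
    erw [← HomologicalComplex.exactAt_iff_isZero_homology]
    rw [HomologicalComplex.exactAt_iff' _ (n + 2) (n + 1) n (by simp) (by simp),
      ShortComplex.ShortExact.moduleCat_exact_iff_function_exact]
    exact Iff.rfl
  have hd : (P.complex.d (n + 1) n).hom ∘ₗ (P.complex.d (n + 2) (n + 1)).hom = 0 := by
    rw [← ModuleCat.hom_comp, P.complex.d_comp_d]; rfl
  rw [h₁, ← LinearMap.rTensor_exact_iff_lTensor_exact, rTensor_exact_iff_forall_linearMap _ hd]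
  constructor
  · refine fun h ↦ subsingleton_of_forall_eq 0 fun e ↦ ?_
    obtain ⟨f, hf, rfl⟩ := P.extMk_surjective e (n + 2) rfl
    obtain ⟨v, hv⟩ := h f.hom (by rw [← ModuleCat.hom_comp, hf]; rfl)
    exact (P.extMk_eq_zero_iff f (n + 2) rfl hf n rfl).2
      ⟨ModuleCat.ofHom v, ModuleCat.hom_ext hv⟩
  · intro h u hu
    obtain ⟨g, hg⟩ := (P.extMk_eq_zero_iff (ModuleCat.ofHom u) (n + 2) rfl
      (ModuleCat.hom_ext hu) n rfl).1 (Subsingleton.elim _ _)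
    exact ⟨g.hom, congrArg ModuleCat.Hom.hom hg⟩

end Bridge

section Dimensions

variable {R : Type u} [CommRing R]

lemma sInf_vanishing_le_iff (P : ℕ → Prop) (n : ℕ) :
    sInf {d : ℕ∞ | ∀ i : ℕ, d < (i : ℕ∞) → P i} ≤ (n : ℕ∞) ↔ ∀ i : ℕ, n < i → P i := by
  constructor
  · intro h i hi
    have hne : {d : ℕ∞ | ∀ i : ℕ, d < (i : ℕ∞) → P i}.Nonempty :=
      ⟨⊤, fun i hi ↦ absurd hi not_top_lt⟩
    exact csInf_mem hne i (h.trans_lt (by exact_mod_cast hi))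
  · exact fun h ↦ sInf_le fun i hi ↦ h i (by exact_mod_cast hi)

/-- Vanishing of `Tor_i(-, M)` for `i > n`, phrased through character modules. -/
def HasFlatDimensionLE (M : ModuleCat.{u} R) (n : ℕ) : Prop :=
  ∀ (N : ModuleCat.{u} R) (i : ℕ), n < i →
    Subsingleton (Abelian.Ext M (ModuleCat.of R (CharacterModule N)) i)

lemma flatDim_le_iff (M : ModuleCat.{u} R) (n : ℕ) :
    flatDim R M ≤ n ↔ HasFlatDimensionLE M n := by
  have := sInf_vanishing_le_iff (fun i ↦ ∀ N : ModuleCat.{u} R, Subsingleton (torRMod R N M i)) n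
  rw [flatDim, HasFlatDimensionLE, forall_comm]
  simp only [forall_comm (α := ModuleCat.{u} R)]
  rw [this]
  refine forall_congr' fun i ↦ forall_congr' fun hi ↦ forall_congr' fun N ↦ ?_
  obtain ⟨i, rfl⟩ := Nat.exists_eq_succ_of_ne_zero (Nat.ne_zero_of_lt hi)
  exact subsingleton_torRMod_succ_iff N M i

lemma projDim_le_iff (M : ModuleCat.{u} R) (n : ℕ) :
    projDim R M ≤ n ↔ HasProjectiveDimensionLE M n := by
  have := sInf_vanishing_le_iff (fun i ↦ ∀ N : ModuleCat.{u} R, Subsingleton (extRMod R M N i)) n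
  rw [projDim, HasProjectiveDimensionLE, hasProjectiveDimensionLT_iff]
  simp only [forall_comm (α := ModuleCat.{u} R)]
  rw [this]
  refine forall_congr' fun i ↦ forall_congr' fun hi ↦ forall_congr' fun N ↦ ?_
  obtain ⟨i, rfl⟩ := Nat.exists_eq_succ_of_ne_zero (Nat.ne_zero_of_lt hi)
  rw [subsingleton_extRMod_succ_iff, subsingleton_iff_forall_eq 0]

lemma injDim_le_iff (M : ModuleCat.{u} R) (n : ℕ) :
    injDim R M ≤ n ↔ HasInjectiveDimensionLE M n := by
  have := sInf_vanishing_le_iff (fun i ↦ ∀ N : ModuleCat.{u} R, Subsingleton (extRMod R N M i)) n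
  rw [injDim, HasInjectiveDimensionLE, hasInjectiveDimensionLT_iff]
  simp only [forall_comm (α := ModuleCat.{u} R)]
  rw [this]
  refine forall_congr' fun i ↦ forall_congr' fun hi ↦ forall_congr' fun N ↦ ?_
  obtain ⟨i, rfl⟩ := Nat.exists_eq_succ_of_ne_zero (Nat.ne_zero_of_lt hi)
  rw [subsingleton_extRMod_succ_iff, subsingleton_iff_forall_eq 0]

end Dimensions

section Shift

variable {R : Type u} [CommRing R]

section

variable {K F M : Type u} [AddCommGroup K] [Module R K] [AddCommGroup F] [Module R F]
  [AddCommGroup M] [Module R M] {g : K →ₗ[R] F} {f : F →ₗ[R] M}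

lemma shortExact_of_linearMap (hg : Function.Injective g) (hgf : Function.Exact g f)
    (hf : Function.Surjective f) :
    (ModuleCat.shortComplexOfCompEqZero g f hgf.linearMap_comp_eq_zero).ShortExact :=
  ModuleCat.shortComplex_shortExact _ hgf hg hf

lemma hasProjectiveDimensionLE_zero_iff (M : Type u) [AddCommGroup M] [Module R M] :
    HasProjectiveDimensionLE (ModuleCat.of R M) 0 ↔ Module.Projective R M := by
  rw [← projective_iff_hasProjectiveDimensionLE_zero, IsProjective.iff_projective]

lemma hasInjectiveDimensionLE_zero_iff (M : Type u) [AddCommGroup M] [Module R M] :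
    HasInjectiveDimensionLE (ModuleCat.of R M) 0 ↔ Module.Injective R M := by
  rw [Module.injective_iff_injective_object]
  exact injective_iff_hasInjectiveDimensionLT_one.symm

lemma hasProjectiveDimensionLE_succ_iff (hg : Function.Injective g) (hgf : Function.Exact g f)
    (hf : Function.Surjective f) [Module.Projective R F] (n : ℕ) :
    HasProjectiveDimensionLE (ModuleCat.of R M) (n + 1) ↔
      HasProjectiveDimensionLE (ModuleCat.of R K) n :=
  (shortExact_of_linearMap hg hgf hf).hasProjectiveDimensionLT_X₃_iff n
    ((IsProjective.iff_projective F).1 inferInstance)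

lemma hasInjectiveDimensionLE_succ_iff (hg : Function.Injective g) (hgf : Function.Exact g f)
    (hf : Function.Surjective f) (hF : Module.Injective R F) (n : ℕ) :
    HasInjectiveDimensionLE (ModuleCat.of R K) (n + 1) ↔
      HasInjectiveDimensionLE (ModuleCat.of R M) n :=
  ((shortExact_of_linearMap hg hgf hf).hasInjectiveDimensionLT_X₃_iff n
    ((Module.injective_iff_injective_object R F).1 hF)).symm

lemma hasFlatDimensionLE_succ_iff (hg : Function.Injective g) (hgf : Function.Exact g f)
    (hf : Function.Surjective f) [Module.Projective R F] (n : ℕ) :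
    HasFlatDimensionLE (ModuleCat.of R M) (n + 1) ↔ HasFlatDimensionLE (ModuleCat.of R K) n := by
  have hS := shortExact_of_linearMap hg hgf hf
  have : Projective (ModuleCat.of R F) := (IsProjective.iff_projective F).1 inferInstance
  constructor
  · intro h N i hi
    refine subsingleton_of_forall_eq 0 fun e ↦ ?_
    obtain ⟨i, rfl⟩ := Nat.exists_eq_succ_of_ne_zero (Nat.ne_zero_of_lt hi)
    have := h N (i + 2) (by lia)
    obtain ⟨e', rfl⟩ := Abelian.Ext.contravariant_sequence_exact₁ hS _ e (add_comm _ _)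
      (Subsingleton.elim (α := Abelian.Ext (ModuleCat.of R M) _ (i + 2)) _ _)
    have : e' = 0 := e'.eq_zero_of_projective
    rw [this, Abelian.Ext.comp_zero]
  · intro h N i hi
    refine subsingleton_of_forall_eq 0 fun e ↦ ?_
    obtain ⟨i, rfl⟩ : ∃ j, i = j + 2 := ⟨i - 2, by lia⟩
    obtain ⟨e', rfl⟩ := Abelian.Ext.contravariant_sequence_exact₃ hS _ e
      (Abelian.Ext.eq_zero_of_projective _) (add_comm 1 (i + 1))
    have := h N (i + 1) (by lia)
    have : e' = 0 := Subsingleton.elim (α := Abelian.Ext (ModuleCat.of R K) _ (i + 1)) _ _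
    rw [this, Abelian.Ext.comp_zero]

lemma exists_extension_of_subsingleton_ext_one (hg : Function.Injective g)
    (hgf : Function.Exact g f) (hf : Function.Surjective f) (N : Type u) [AddCommGroup N]
    [Module R N] (h : Subsingleton (Abelian.Ext (ModuleCat.of R M) (ModuleCat.of R N) 1))
    (φ : K →ₗ[R] N) : ∃ ψ : F →ₗ[R] N, ψ ∘ₗ g = φ := by
  have hS := shortExact_of_linearMap hg hgf hf
  obtain ⟨e, he⟩ := Abelian.Ext.contravariant_sequence_exact₁ hS _
    (Abelian.Ext.mk₀ (ModuleCat.ofHom φ)) (add_comm 0 1)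
    (Subsingleton.elim (α := Abelian.Ext (ModuleCat.of R M) _ 1) _ _)
  obtain ⟨ψ, rfl⟩ := Abelian.Ext.homEquiv₀.symm.surjective e
  refine ⟨ψ.hom, ?_⟩
  erw [Abelian.Ext.mk₀_comp_mk₀] at he
  exact congrArg ModuleCat.Hom.hom (Abelian.Ext.homEquiv₀.symm.injective he)

/-- `Ext¹(M, N⋆)` vanishes iff `K ⊗ N → F ⊗ N` is injective. -/
lemma subsingleton_ext_one_characterModule_iff (hg : Function.Injective g)
    (hgf : Function.Exact g f) (hf : Function.Surjective f) [Module.Projective R F]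
    (N : Type u) [AddCommGroup N] [Module R N] :
    Subsingleton (Abelian.Ext (ModuleCat.of R M) (ModuleCat.of R (CharacterModule N)) 1) ↔
      Function.Injective (g.rTensor N) := by
  have hS := shortExact_of_linearMap hg hgf hf
  have : Projective (ModuleCat.of R F) := (IsProjective.iff_projective F).1 inferInstance
  rw [rTensor_injective_iff_lcomp_surjective]
  constructor
  · exact fun h ↦ exists_extension_of_subsingleton_ext_one hg hgf hf _ h
  · intro h
    refine subsingleton_of_forall_eq 0 fun e ↦ ?_
    obtain ⟨e', rfl⟩ := Abelian.Ext.contravariant_sequence_exact₃ hS _ e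
      (Abelian.Ext.eq_zero_of_projective _) (add_comm 1 0)
    obtain ⟨φ, rfl⟩ := Abelian.Ext.homEquiv₀.symm.surjective e'
    obtain ⟨ψ, hψ⟩ := h φ.hom
    have h₂ : φ = (ModuleCat.ofHom g) ≫ (ModuleCat.ofHom ψ) := ModuleCat.hom_ext hψ.symm
    have h₃ := hS.extClass_comp_assoc (Abelian.Ext.mk₀ (ModuleCat.ofHom ψ)) (h := add_comm 1 0)
    rw [Abelian.Ext.mk₀_comp_mk₀] at h₃
    rw [h₂]
    exact h₃

lemma Module.Flat.of_exact (hg : Function.Injective g) (hgf : Function.Exact g f)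
    (hf : Function.Surjective f) [Module.Flat R F] [Module.Flat R M] : Module.Flat R K := by
  rw [Module.Flat.iff_rTensor_preserves_injective_linearMap]
  intro A B _ _ _ _ i hi
  have h₁ : Function.Injective (g.lTensor A) :=
    LinearMap.lTensor_injective_of_exact_of_flat f hf g hg hgf A
  have h₂ : Function.Injective (i.rTensor F) :=
    Module.Flat.rTensor_preserves_injective_linearMap _ hi
  have h₃ : g.lTensor B ∘ₗ i.rTensor K = i.rTensor F ∘ₗ g.lTensor A := by
    rw [LinearMap.lTensor_comp_rTensor, LinearMap.rTensor_comp_lTensor]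
  have h₄ : Function.Injective (g.lTensor B ∘ₗ i.rTensor K) := by
    rw [h₃]; exact h₂.comp h₁
  exact Function.Injective.of_comp (f := g.lTensor B) h₄

end

lemma exists_projective_cover (R M : Type u) [CommRing R] [AddCommGroup M] [Module R M] :
    ∃ (F : Type u) (_ : AddCommGroup F) (_ : Module R F) (f : F →ₗ[R] M),
      Module.Projective R F ∧ Function.Surjective f :=
  ⟨M →₀ R, inferInstance, inferInstance, Finsupp.linearCombination R id, inferInstance,
    Finsupp.linearCombination_id_surjective R M⟩

lemma subsingleton_ext_characterModule_of_flat (N : Type u) [AddCommGroup N] [Module R N] (i : ℕ)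
    (M : Type u) [AddCommGroup M] [Module R M] [Module.Flat R M] :
    Subsingleton
      (Abelian.Ext (ModuleCat.of R M) (ModuleCat.of R (CharacterModule N)) (i + 1)) := by
  induction i generalizing M with
  | zero =>
    obtain ⟨F, _, _, f, _, hf⟩ := exists_projective_cover R M
    rw [subsingleton_ext_one_characterModule_iff (LinearMap.ker f).subtype_injective
      f.exact_subtype_ker_map hf, ← LinearMap.lTensor_inj_iff_rTensor_inj]
    exact LinearMap.lTensor_injective_of_exact_of_flat f hf _ (LinearMap.ker f).subtype_injective
      f.exact_subtype_ker_map _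
  | succ i ih =>
    obtain ⟨F, _, _, f, _, hf⟩ := exists_projective_cover R M
    have hS := shortExact_of_linearMap (LinearMap.ker f).subtype_injective
      f.exact_subtype_ker_map hf
    have : Module.Flat R (LinearMap.ker f) :=
      .of_exact (LinearMap.ker f).subtype_injective f.exact_subtype_ker_map hf
    have : Projective (ModuleCat.of R F) := (IsProjective.iff_projective F).1 inferInstance
    refine subsingleton_of_forall_eq 0 fun e ↦ ?_
    obtain ⟨e', rfl⟩ := Abelian.Ext.contravariant_sequence_exact₃ hS _ e
      (Abelian.Ext.eq_zero_of_projective _) (add_comm 1 (i + 1))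
    have := ih (LinearMap.ker f)
    have : e' = 0 := Subsingleton.elim
      (α := Abelian.Ext (ModuleCat.of R (LinearMap.ker f)) _ (i + 1)) _ _
    rw [this, Abelian.Ext.comp_zero]

lemma hasFlatDimensionLE_zero_iff (M : Type u) [AddCommGroup M] [Module R M] :
    HasFlatDimensionLE (ModuleCat.of R M) 0 ↔ Module.Flat R M := by
  constructor
  · intro h
    obtain ⟨F, _, _, f, _, hf⟩ := exists_projective_cover R M
    rw [Module.Flat.iff_lTensor_preserves_injective_linearMap'.{u, u, u}]
    intro A B _ _ _ _ i hi
    refine lTensor_injective_of_exact_of_exact_of_rTensor_injective f.exact_subtype_ker_map hf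
      i.exact_map_mkQ_range (Submodule.mkQ_surjective _) ?_
      (Module.Flat.lTensor_preserves_injective_linearMap _ hi)
    rw [← subsingleton_ext_one_characterModule_iff (LinearMap.ker f).subtype_injective
      f.exact_subtype_ker_map hf]
    exact h (ModuleCat.of R _) 1 zero_lt_one
  · intro h N i hi
    obtain ⟨i, rfl⟩ := Nat.exists_eq_succ_of_ne_zero hi.ne'
    exact subsingleton_ext_characterModule_of_flat N i M

lemma hasFlatDimensionLE_of_hasProjectiveDimensionLE {M : ModuleCat.{u} R} {n : ℕ}
    (h : HasProjectiveDimensionLE M n) : HasFlatDimensionLE M n := by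
  intro N i hi
  exact subsingleton_of_forall_eq 0 fun e ↦ (hasProjectiveDimensionLT_iff _ _).1 h i hi e

lemma HasFlatDimensionLE.of_linearEquiv {M N : Type u} [AddCommGroup M] [Module R M]
    [AddCommGroup N] [Module R N] (e : M ≃ₗ[R] N) {n : ℕ}
    (h : HasFlatDimensionLE (ModuleCat.of R M) n) : HasFlatDimensionLE (ModuleCat.of R N) n := by
  cases n with
  | zero =>
    rw [hasFlatDimensionLE_zero_iff] at h ⊢
    exact Module.Flat.of_linearEquiv e.symm
  | succ n =>
    obtain ⟨F, _, _, f, _, hf⟩ := exists_projective_cover R M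
    rw [hasFlatDimensionLE_succ_iff (LinearMap.ker f).subtype_injective
      f.exact_subtype_ker_map hf] at h
    refine (hasFlatDimensionLE_succ_iff (f := e.toLinearMap ∘ₗ f)
      (LinearMap.ker f).subtype_injective ?_ (e.surjective.comp hf) n).2 h
    intro a
    simp

end Shift

section ExactPair

/-- The kernel of `x` on `M` is the image of `y`, and conversely. -/
structure IsExactPairOn {R : Type*} [CommRing R] (M : Type*) [AddCommGroup M] [Module R M]
    (x y : R) : Prop where
  exists_smul_eq : ∀ m : M, x • m = 0 → ∃ m' : M, y • m' = m
  exists_smul_eq' : ∀ m : M, y • m = 0 → ∃ m' : M, x • m' = m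
  mul_eq_zero : x * y = 0

namespace IsExactPairOn

variable {R : Type*} [CommRing R] {x y : R}

lemma symm {M : Type*} [AddCommGroup M] [Module R M] (h : IsExactPairOn M x y) :
    IsExactPairOn M y x :=
  ⟨h.exists_smul_eq', h.exists_smul_eq, by rw [mul_comm, h.mul_eq_zero]⟩

lemma exact {M : Type*} [AddCommGroup M] [Module R M] (h : IsExactPairOn M x y) :
    Function.Exact (LinearMap.lsmul R M y) (LinearMap.lsmul R M x) := by
  intro m
  refine ⟨fun hm ↦ h.exists_smul_eq m hm, ?_⟩
  rintro ⟨m, rfl⟩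
  rw [LinearMap.lsmul_apply, LinearMap.lsmul_apply, smul_smul, h.mul_eq_zero, zero_smul]

lemma of_flat (h : IsExactPairOn R x y) (M : Type*) [AddCommGroup M] [Module R M]
    [Module.Flat R M] : IsExactPairOn M x y := by
  have key {x y : R} (h : IsExactPairOn R x y) (m : M) (hm : x • m = 0) : ∃ m' : M, y • m' = m := by
    obtain ⟨t, ht⟩ := (Module.Flat.lTensor_exact M h.exact (TensorProduct.tmul R m (1 : R))).1 (by
      simp only [LinearMap.lTensor_tmul, LinearMap.lsmul_apply]
      rw [TensorProduct.tmul_smul, TensorProduct.smul_tmul', hm, TensorProduct.zero_tmul])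
    refine ⟨TensorProduct.rid R M t, ?_⟩
    rw [← map_smul]
    have : (LinearMap.lsmul R R y).lTensor M t = y • t := by
      rw [← LinearMap.lsmul_apply (R := R) (M := TensorProduct R M R)]
      congr 1
      ext
      simp [← TensorProduct.tmul_smul]
    rw [← this, ht]
    simp
  exact ⟨key h, key h.symm, h.mul_eq_zero⟩

lemma of_injective {R : Type u} [CommRing R] {x y : R} (h : IsExactPairOn R x y) (M : Type u)
    [AddCommGroup M] [Module R M] (hM : Module.Injective R M) : IsExactPairOn M x y := by
  have key {x y : R} (h : IsExactPairOn R x y) (m : M) (hm : x • m = 0) : ∃ m' : M, y • m' = m := by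
    let a := LinearMap.toSpanSingleton R R y
    have hle : LinearMap.ker a ≤ LinearMap.ker (LinearMap.toSpanSingleton R M m) := by
      intro r hr
      obtain ⟨s, rfl⟩ := h.exists_smul_eq' r (by simpa [a, mul_comm] using hr)
      rw [LinearMap.mem_ker, LinearMap.toSpanSingleton_apply, smul_assoc, smul_comm, hm, smul_zero]
    obtain ⟨φ, hφ⟩ := hM.out ((LinearMap.ker a).liftQ a le_rfl)
      (LinearMap.ker_eq_bot.1 (Submodule.ker_liftQ_eq_bot _ _ _ le_rfl))
      ((LinearMap.ker a).liftQ (LinearMap.toSpanSingleton R M m) hle)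
    refine ⟨φ 1, ?_⟩
    have := hφ (Submodule.Quotient.mk 1)
    simp only [Submodule.liftQ_apply, a, LinearMap.toSpanSingleton_apply, one_smul] at this
    rw [← this, ← map_smul, smul_eq_mul, mul_one]
  exact ⟨key h, key h.symm, h.mul_eq_zero⟩

variable {K F M : Type*} [AddCommGroup K] [Module R K] [AddCommGroup F] [Module R F]
  [AddCommGroup M] [Module R M] {g : K →ₗ[R] F} {f : F →ₗ[R] M}

lemma of_exact_right (hg : Function.Injective g) (hgf : Function.Exact g f)
    (hf : Function.Surjective f) (hK : IsExactPairOn K x y) (hF : IsExactPairOn F x y) :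
    IsExactPairOn M x y := by
  have key {x y : R} (hK : IsExactPairOn K x y) (hF : IsExactPairOn F x y) (m : M)
      (hm : x • m = 0) : ∃ m' : M, y • m' = m := by
    obtain ⟨b, rfl⟩ := hf m
    obtain ⟨k, hk⟩ := (hgf (x • b)).1 (by rw [map_smul, hm])
    obtain ⟨k', rfl⟩ := hK.exists_smul_eq' k (hg (by
      rw [map_smul, hk, ← mul_smul, hK.symm.mul_eq_zero, zero_smul, map_zero]))
    obtain ⟨b', hb'⟩ := hF.exists_smul_eq (b - g k') (by
      rw [smul_sub, ← map_smul, hk, sub_self])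
    exact ⟨f b', by rw [← map_smul, hb', map_sub, hgf.apply_apply_eq_zero, sub_zero]⟩
  exact ⟨key hK hF, key hK.symm hF.symm, hK.mul_eq_zero⟩

lemma of_exact_left (hg : Function.Injective g) (hgf : Function.Exact g f)
    (hf : Function.Surjective f) (hF : IsExactPairOn F x y) (hM : IsExactPairOn M x y) :
    IsExactPairOn K x y := by
  have key {x y : R} (hF : IsExactPairOn F x y) (hM : IsExactPairOn M x y) (k : K)
      (hk : x • k = 0) : ∃ k' : K, y • k' = k := by
    obtain ⟨b, hb⟩ := hF.exists_smul_eq (g k) (by rw [← map_smul, hk, map_zero])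
    obtain ⟨m', hm'⟩ := hM.exists_smul_eq' (f b) (by
      rw [← map_smul, hb, hgf.apply_apply_eq_zero])
    obtain ⟨b', rfl⟩ := hf m'
    obtain ⟨k', hk'⟩ := (hgf (b - x • b')).1 (by rw [map_sub, map_smul, hm', sub_self])
    refine ⟨k', hg ?_⟩
    rw [map_smul, hk', smul_sub, ← mul_smul, hF.symm.mul_eq_zero, zero_smul, sub_zero, hb]
  exact ⟨key hF hM, key hF.symm hM.symm, hF.mul_eq_zero⟩

end IsExactPairOn

variable {R : Type u} [CommRing R] {x y : R}

lemma IsExactPairOn.of_hasFlatDimensionLE (h : IsExactPairOn R x y) (n : ℕ) (M : Type u)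
    [AddCommGroup M] [Module R M] (hM : HasFlatDimensionLE (ModuleCat.of R M) n) :
    IsExactPairOn M x y := by
  induction n generalizing M with
  | zero =>
    have := (hasFlatDimensionLE_zero_iff M).1 hM
    exact h.of_flat M
  | succ n ih =>
    obtain ⟨F, _, _, f, _, hf⟩ := exists_projective_cover R M
    exact .of_exact_right (LinearMap.ker f).subtype_injective f.exact_subtype_ker_map hf
      (ih _ ((hasFlatDimensionLE_succ_iff (LinearMap.ker f).subtype_injective
        f.exact_subtype_ker_map hf n).1 hM)) (h.of_flat F)

lemma exists_injective_embedding (M : Type u) [AddCommGroup M] [Module R M] :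
    ∃ (I : Type u) (_ : AddCommGroup I) (_ : Module R I) (g : M →ₗ[R] I),
      Module.Injective R I ∧ Function.Injective g :=
  ⟨(Injective.under (ModuleCat.of R M) : ModuleCat.{u} R), inferInstance, inferInstance,
    (Injective.ι (ModuleCat.of R M)).hom, (Module.injective_iff_injective_object R _).2
      (Injective.injective_under _), (ModuleCat.mono_iff_injective _).1 inferInstance⟩

lemma IsExactPairOn.of_hasInjectiveDimensionLE (h : IsExactPairOn R x y) (n : ℕ) (M : Type u)
    [AddCommGroup M] [Module R M] (hM : HasInjectiveDimensionLE (ModuleCat.of R M) n) :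
    IsExactPairOn M x y := by
  induction n generalizing M with
  | zero => exact h.of_injective M ((hasInjectiveDimensionLE_zero_iff M).1 hM)
  | succ n ih =>
    obtain ⟨I, _, _, g, hI, hg⟩ := exists_injective_embedding (R := R) M
    exact .of_exact_left hg g.exact_map_mkQ_range (Submodule.mkQ_surjective _)
      (h.of_injective I hI) (ih _ ((hasInjectiveDimensionLE_succ_iff hg g.exact_map_mkQ_range
        (Submodule.mkQ_surjective _) hI n).1 hM))

lemma isEZDPair_iff {M : Type*} [AddCommGroup M] [Module R M] (hxy : x * y = 0)
    (hM1 : Ideal.span {x} • (⊤ : Submodule R M) ≠ ⊤) (hM2 : ∃ m : M, x • m ≠ 0) :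
    IsEZDPair R M x y ↔ IsExactPairOn M x y := by
  rw [IsEZDPair, and_iff_right hM1, and_iff_right hM2]
  simp only [Submodule.ext_iff,
    Submodule.mem_torsionBy_iff, Submodule.ideal_span_singleton_smul,
    Submodule.mem_smul_pointwise_iff_exists, Submodule.mem_top, true_and]
  refine ⟨fun h ↦ ⟨fun m ↦ (h.1 m).1, fun m ↦ (h.2 m).1, hxy⟩, fun h ↦
    ⟨fun m ↦ ⟨h.1 m, ?_⟩, fun m ↦ ⟨h.2 m, ?_⟩⟩⟩
  · rintro ⟨m, rfl⟩
    rw [← mul_smul, hxy, zero_smul]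
  · rintro ⟨m, rfl⟩
    rw [← mul_smul, mul_comm, hxy, zero_smul]

lemma IsEZDPair.mul_eq_zero (h : IsEZDPair R R x y) : x * y = 0 := by
  have : y ∈ Ideal.span {y} • (⊤ : Submodule R R) := by
    rw [Submodule.ideal_span_singleton_smul, Submodule.mem_smul_pointwise_iff_exists]
    exact ⟨1, trivial, by simp⟩
  rw [← h.2.2.1] at this
  simpa using this

end ExactPair

section Reduction

open scoped TensorProduct

variable {R : Type u} [CommRing R] {x y : R}

section BaseChange

variable (x) in
lemma one_tmul_eq_zero_iff {M : Type*} [AddCommGroup M] [Module R M] (m : M) :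
    (1 : R ⧸ Ideal.span {x}) ⊗ₜ[R] m = 0 ↔ ∃ m' : M, x • m' = m := by
  rw [← (TensorProduct.quotTensorEquivQuotSMul M (Ideal.span {x})).map_eq_zero_iff]
  have := TensorProduct.quotTensorEquivQuotSMul_mk_tmul (Ideal.span {x}) 1 m
  rw [map_one] at this
  rw [this, one_smul, Submodule.Quotient.mk_eq_zero, Submodule.ideal_span_singleton_smul,
    Submodule.mem_smul_pointwise_iff_exists]
  simp

variable {K F M : Type u} [AddCommGroup K] [Module R K] [AddCommGroup F] [Module R F]
  [AddCommGroup M] [Module R M] {g : K →ₗ[R] F} {f : F →ₗ[R] M}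

lemma IsExactPairOn.baseChange_injective (hg : Function.Injective g) (hgf : Function.Exact g f)
    (hf : Function.Surjective f) (hM : IsExactPairOn M x y) :
    Function.Injective (g.baseChange (R ⧸ Ideal.span {x})) := by
  rw [injective_iff_map_eq_zero]
  intro t ht
  obtain ⟨k, rfl⟩ := TensorProduct.mk_surjective R K (R ⧸ Ideal.span {x})
    Ideal.Quotient.mk_surjective t
  rw [TensorProduct.mk_apply, LinearMap.baseChange_tmul, one_tmul_eq_zero_iff] at ht
  rw [TensorProduct.mk_apply, one_tmul_eq_zero_iff]
  obtain ⟨b, hb⟩ := ht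
  obtain ⟨m', hm'⟩ := hM.exists_smul_eq (f b) (by
    rw [← map_smul, hb, hgf.apply_apply_eq_zero])
  obtain ⟨b', rfl⟩ := hf m'
  obtain ⟨k', hk'⟩ := (hgf (b - y • b')).1 (by rw [map_sub, map_smul, hm', sub_self])
  exact ⟨k', hg (by rw [map_smul, hk', smul_sub, ← mul_smul, hM.mul_eq_zero, zero_smul,
    sub_zero, hb])⟩

lemma LinearMap.baseChange_exact (S : Type u) [CommRing S] [Algebra R S]
    (hgf : Function.Exact g f) (hf : Function.Surjective f) :
    Function.Exact (g.baseChange S) (f.baseChange S) :=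
  lTensor_exact S hgf hf

lemma LinearMap.baseChange_surjective' (S : Type u) [CommRing S] [Algebra R S]
    (hf : Function.Surjective f) : Function.Surjective (f.baseChange S) :=
  LinearMap.lTensor_surjective S hf

lemma IsExactPairOn.hasProjectiveDimensionLE_baseChange (h : IsExactPairOn R x y) (n : ℕ)
    (M : Type u) [AddCommGroup M] [Module R M]
    (hM : HasProjectiveDimensionLE (ModuleCat.of R M) n) :
    HasProjectiveDimensionLE
      (ModuleCat.of (R ⧸ Ideal.span {x}) ((R ⧸ Ideal.span {x}) ⊗[R] M)) n := by
  induction n generalizing M with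
  | zero =>
    rw [hasProjectiveDimensionLE_zero_iff] at hM ⊢
    infer_instance
  | succ n ih =>
    obtain ⟨F, _, _, f, _, hf⟩ := exists_projective_cover R M
    have hEM := h.of_hasFlatDimensionLE _ _ (hasFlatDimensionLE_of_hasProjectiveDimensionLE hM)
    rw [hasProjectiveDimensionLE_succ_iff
      (hEM.baseChange_injective (LinearMap.ker f).subtype_injective f.exact_subtype_ker_map hf)
      (LinearMap.baseChange_exact _ f.exact_subtype_ker_map hf)
      (LinearMap.baseChange_surjective' _ hf)]
    exact ih _ ((hasProjectiveDimensionLE_succ_iff (LinearMap.ker f).subtype_injective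
      f.exact_subtype_ker_map hf n).1 hM)

lemma IsExactPairOn.hasFlatDimensionLE_baseChange (h : IsExactPairOn R x y) (n : ℕ)
    (M : Type u) [AddCommGroup M] [Module R M]
    (hM : HasFlatDimensionLE (ModuleCat.of R M) n) :
    HasFlatDimensionLE
      (ModuleCat.of (R ⧸ Ideal.span {x}) ((R ⧸ Ideal.span {x}) ⊗[R] M)) n := by
  induction n generalizing M with
  | zero =>
    rw [hasFlatDimensionLE_zero_iff] at hM ⊢
    infer_instance
  | succ n ih =>
    obtain ⟨F, _, _, f, _, hf⟩ := exists_projective_cover R M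
    have hEM := h.of_hasFlatDimensionLE _ _ hM
    rw [hasFlatDimensionLE_succ_iff
      (hEM.baseChange_injective (LinearMap.ker f).subtype_injective f.exact_subtype_ker_map hf)
      (LinearMap.baseChange_exact _ f.exact_subtype_ker_map hf)
      (LinearMap.baseChange_surjective' _ hf)]
    exact ih _ ((hasFlatDimensionLE_succ_iff (LinearMap.ker f).subtype_injective
      f.exact_subtype_ker_map hf n).1 hM)

variable (x) in
/-- `R/(x) ⊗ M` is `M/xM` as an `R/(x)`-module. -/
noncomputable def baseChangeEquivQuotient (M : Type*) [AddCommGroup M] [Module R M] :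
    (R ⧸ Ideal.span {x}) ⊗[R] M ≃ₗ[R ⧸ Ideal.span {x}]
      M ⧸ (Ideal.span {x} • (⊤ : Submodule R M)) :=
  (TensorProduct.quotTensorEquivQuotSMul M (Ideal.span {x})).extendScalarsOfSurjective
    Ideal.Quotient.mk_surjective

end BaseChange

section Torsion

/-- The map induced on `x`-torsion, as a map of `R/(x)`-modules. -/
noncomputable def torsionByMap (x : R) {M N : Type*} [AddCommGroup M] [Module R M]
    [AddCommGroup N] [Module R N] (f : M →ₗ[R] N) :
    Submodule.torsionBy R M x →ₗ[R ⧸ Ideal.span {x}] Submodule.torsionBy R N x :=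
  (f.restrict (p := Submodule.torsionBy R M x) (q := Submodule.torsionBy R N x) fun m hm ↦ by
    rw [Submodule.mem_torsionBy_iff] at hm ⊢
    rw [← map_smul, hm, map_zero]).extendScalarsOfSurjective Ideal.Quotient.mk_surjective

variable {K F M : Type u} [AddCommGroup K] [Module R K] [AddCommGroup F] [Module R F]
  [AddCommGroup M] [Module R M] {g : K →ₗ[R] F} {f : F →ₗ[R] M}

lemma torsionByMap_injective (x : R) (hg : Function.Injective g) :
    Function.Injective (torsionByMap x g) :=
  fun _ _ h ↦ Subtype.ext (hg (congrArg Subtype.val h))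

lemma torsionByMap_exact (x : R) (hg : Function.Injective g) (hgf : Function.Exact g f) :
    Function.Exact (torsionByMap x g) (torsionByMap x f) := by
  intro b
  constructor
  · intro hb
    obtain ⟨k, hk⟩ := (hgf b).1 (congrArg Subtype.val hb)
    refine ⟨⟨k, hg ?_⟩, Subtype.ext hk⟩
    have := b.2
    rw [Submodule.mem_torsionBy_iff] at this
    change g (x • k) = g 0
    rw [map_smul, hk, this, map_zero]
  · rintro ⟨k, rfl⟩
    exact Subtype.ext (hgf.apply_apply_eq_zero _)

lemma IsExactPairOn.torsionByMap_surjective (hM : IsExactPairOn M x y)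
    (hf : Function.Surjective f) : Function.Surjective (torsionByMap x f) := by
  rintro ⟨m, hm⟩
  obtain ⟨m', rfl⟩ := hM.exists_smul_eq m hm
  obtain ⟨b, rfl⟩ := hf m'
  refine ⟨⟨y • b, ?_⟩, Subtype.ext (map_smul f y b)⟩
  rw [Submodule.mem_torsionBy_iff, ← mul_smul, hM.mul_eq_zero, zero_smul]

lemma injective_torsionBy (x : R) (I : Type u) [AddCommGroup I] [Module R I]
    (hI : Module.Injective R I) :
    Module.Injective (R ⧸ Ideal.span {x}) (Submodule.torsionBy R I x) := by
  refine Module.Baer.injective fun J φ ↦ ?_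
  obtain ⟨ψ, hψ⟩ := hI.out (J.subtype.restrictScalars R) J.subtype_injective
    ((Submodule.torsionBy R I x).subtype ∘ₗ φ.restrictScalars R)
  have hx : x • ψ 1 = 0 := by
    rw [← map_smul, Algebra.smul_def, Ideal.Quotient.algebraMap_eq,
      Ideal.Quotient.eq_zero_iff_mem.2 (Ideal.mem_span_singleton_self x), zero_mul, map_zero]
  refine ⟨LinearMap.toSpanSingleton _ _ ⟨ψ 1, hx⟩, fun s hs ↦ Subtype.ext ?_⟩
  rw [LinearMap.toSpanSingleton_apply]
  refine Eq.trans ?_ (hψ ⟨s, hs⟩)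
  obtain ⟨r, rfl⟩ := Ideal.Quotient.mk_surjective s
  rw [Submodule.torsionBy.mk_ideal_smul]
  change r • ψ 1 = ψ (Ideal.Quotient.mk _ r)
  rw [← map_smul, Algebra.smul_def, mul_one]
  rfl

lemma IsExactPairOn.hasInjectiveDimensionLE_torsionBy (h : IsExactPairOn R x y) (n : ℕ)
    (M : Type u) [AddCommGroup M] [Module R M]
    (hM : HasInjectiveDimensionLE (ModuleCat.of R M) n) :
    HasInjectiveDimensionLE
      (ModuleCat.of (R ⧸ Ideal.span {x}) (Submodule.torsionBy R M x)) n := by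
  induction n generalizing M with
  | zero =>
    rw [hasInjectiveDimensionLE_zero_iff] at hM ⊢
    exact injective_torsionBy x M hM
  | succ n ih =>
    obtain ⟨I, _, _, g, hI, hg⟩ := exists_injective_embedding (R := R) M
    have hC := (hasInjectiveDimensionLE_succ_iff hg g.exact_map_mkQ_range
      (Submodule.mkQ_surjective _) hI n).1 hM
    have hEC := h.of_hasInjectiveDimensionLE _ _ hC
    exact (hasInjectiveDimensionLE_succ_iff (torsionByMap_injective x hg)
      (torsionByMap_exact x hg g.exact_map_mkQ_range)
      (hEC.torsionByMap_surjective (Submodule.mkQ_surjective _))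
      (injective_torsionBy x I hI) n).2 (ih _ hC)

/-- Multiplication by `y` identifies `M/xM` with the `x`-torsion of `M`. -/
noncomputable def IsExactPairOn.quotientEquivTorsionBy (h : IsExactPairOn M x y) :
    (M ⧸ (Ideal.span {x} • (⊤ : Submodule R M))) ≃ₗ[R ⧸ Ideal.span {x}]
      Submodule.torsionBy R M x :=
  LinearEquiv.extendScalarsOfSurjective Ideal.Quotient.mk_surjective
    ((Submodule.quotEquivOfEq _ _ (by
      ext m
      rw [Submodule.ideal_span_singleton_smul, Submodule.mem_smul_pointwise_iff_exists,
        h.symm.exact.linearMap_ker_eq]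
      simp)) ≪≫ₗ (LinearMap.lsmul R M y).quotKerEquivRange ≪≫ₗ
        LinearEquiv.ofEq _ _ h.exact.linearMap_ker_eq.symm)

end Torsion

end Reduction

section LocalFlat

open scoped TensorProduct

variable {R : Type u} [CommRing R] [IsLocalRing R] {x y : R}

lemma isLocalRing_quotient_span_singleton (hx : ¬ IsUnit x) :
    IsLocalRing (R ⧸ Ideal.span {x}) := by
  have : Nontrivial (R ⧸ Ideal.span {x}) :=
    Ideal.Quotient.nontrivial_iff.2 (by rwa [ne_eq, Ideal.span_singleton_eq_top])
  exact .of_surjective' _ Ideal.Quotient.mk_surjective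

lemma span_singleton_le_jacobson_bot (hx : ¬ IsUnit x) :
    Ideal.span {x} ≤ (⊥ : Ideal R).jacobson := by
  rw [IsLocalRing.jacobson_eq_maximalIdeal ⊥ bot_ne_top]
  exact (Ideal.span_singleton_le_iff_mem _).2 hx

variable {F M : Type u} [AddCommGroup F] [Module R F] [AddCommGroup M] [Module R M]

lemma eq_bot_of_forall_exists_smul_eq {N : Submodule R F} (hN : N.FG) (hx : ¬ IsUnit x)
    (h : ∀ n : N, ∃ n' : N, x • n' = n) : N = ⊥ := by
  rw [eq_bot_iff]
  refine Submodule.le_of_le_smul_of_le_jacobson_bot hN (span_singleton_le_jacobson_bot hx) ?_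
  intro n hn
  obtain ⟨n', hn'⟩ := h ⟨n, hn⟩
  rw [bot_sup_eq, Submodule.ideal_span_singleton_smul, Submodule.mem_smul_pointwise_iff_exists]
  exact ⟨n', n'.2, congrArg Subtype.val hn'⟩

lemma surjective_of_baseChange_surjective [Module.Finite R M] (hx : ¬ IsUnit x) (f : F →ₗ[R] M)
    (h : Function.Surjective (f.baseChange (R ⧸ Ideal.span {x}))) : Function.Surjective f := by
  rw [← LinearMap.range_eq_top, eq_top_iff]
  refine Submodule.le_of_le_smul_of_le_jacobson_bot Module.Finite.fg_top
    (span_singleton_le_jacobson_bot hx) ?_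
  intro m _
  obtain ⟨t, ht⟩ := h (1 ⊗ₜ m)
  obtain ⟨b, rfl⟩ := TensorProduct.mk_surjective R F (R ⧸ Ideal.span {x})
    Ideal.Quotient.mk_surjective t
  rw [TensorProduct.mk_apply, LinearMap.baseChange_tmul, eq_comm, ← sub_eq_zero,
    ← TensorProduct.tmul_sub, one_tmul_eq_zero_iff] at ht
  obtain ⟨m', hm'⟩ := ht
  rw [← sub_add_cancel m (f b), ← hm', add_comm]
  refine Submodule.add_mem_sup ⟨b, rfl⟩ ?_
  rw [Submodule.ideal_span_singleton_smul, Submodule.mem_smul_pointwise_iff_exists]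
  exact ⟨m', trivial, rfl⟩

lemma IsExactPairOn.injective_of_baseChange_injective [IsNoetherianRing R] [Module.Finite R F]
    (hx : ¬ IsUnit x) (hM : IsExactPairOn M x y) (f : F →ₗ[R] M) (hf : Function.Surjective f)
    (h : Function.Injective (f.baseChange (R ⧸ Ideal.span {x}))) : Function.Injective f := by
  rw [← LinearMap.ker_eq_bot]
  refine eq_bot_of_forall_exists_smul_eq (IsNoetherian.noetherian _) hx fun k ↦ ?_
  rw [← one_tmul_eq_zero_iff]
  refine hM.baseChange_injective (LinearMap.ker f).subtype_injective f.exact_subtype_ker_map hf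
    (h ?_)
  simp

lemma IsExactPairOn.free_of_flat_baseChange [IsNoetherianRing R] [Module.Finite R M]
    (hx : ¬ IsUnit x) (hM : IsExactPairOn M x y)
    [Module.Flat (R ⧸ Ideal.span {x}) ((R ⧸ Ideal.span {x}) ⊗[R] M)] : Module.Free R M := by
  have := isLocalRing_quotient_span_singleton hx
  have : Module.Free (R ⧸ Ideal.span {x}) ((R ⧸ Ideal.span {x}) ⊗[R] M) :=
    Module.free_of_flat_of_isLocalRing
  let b := Module.Free.chooseBasis (R ⧸ Ideal.span {x}) ((R ⧸ Ideal.span {x}) ⊗[R] M)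
  choose m hm using fun i ↦ TensorProduct.mk_surjective R M (R ⧸ Ideal.span {x})
    Ideal.Quotient.mk_surjective (b i)
  let f := Finsupp.linearCombination R m
  have hfb : f.baseChange (R ⧸ Ideal.span {x}) =
      ((Finsupp.basisSingleOne.baseChange (R ⧸ Ideal.span {x})).equiv b
        (Equiv.refl _)).toLinearMap := by
    refine (Finsupp.basisSingleOne.baseChange (R ⧸ Ideal.span {x})).ext fun i ↦ ?_
    rw [LinearEquiv.coe_coe, Module.Basis.equiv_apply, Module.Basis.baseChange_apply,
      LinearMap.baseChange_tmul, Equiv.refl_apply, ← hm i]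
    simp [f]
  have hf : Function.Surjective f :=
    surjective_of_baseChange_surjective hx f (by rw [hfb]; exact LinearEquiv.surjective _)
  exact Module.Free.of_equiv (LinearEquiv.ofBijective f
    ⟨hM.injective_of_baseChange_injective hx f hf (by rw [hfb]; exact LinearEquiv.injective _), hf⟩)

lemma IsExactPairOn.hasProjectiveDimensionLE_of_baseChange [IsNoetherianRing R]
    (h : IsExactPairOn R x y) (hx : ¬ IsUnit x) (n : ℕ) (M : Type u) [AddCommGroup M] [Module R M]
    [Module.Finite R M] (hM : IsExactPairOn M x y)
    (hn : HasFlatDimensionLE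
      (ModuleCat.of (R ⧸ Ideal.span {x}) ((R ⧸ Ideal.span {x}) ⊗[R] M)) n) :
    HasProjectiveDimensionLE (ModuleCat.of R M) n := by
  induction n generalizing M with
  | zero =>
    rw [hasFlatDimensionLE_zero_iff] at hn
    rw [hasProjectiveDimensionLE_zero_iff]
    have := hM.free_of_flat_baseChange hx
    infer_instance
  | succ n ih =>
    obtain ⟨k, f, hf⟩ := Module.Finite.exists_fin' R M
    rw [hasProjectiveDimensionLE_succ_iff (LinearMap.ker f).subtype_injective
      f.exact_subtype_ker_map hf]
    rw [hasFlatDimensionLE_succ_iff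
      (hM.baseChange_injective (LinearMap.ker f).subtype_injective f.exact_subtype_ker_map hf)
      (LinearMap.baseChange_exact _ f.exact_subtype_ker_map hf)
      (LinearMap.baseChange_surjective' _ hf)] at hn
    exact ih _ (.of_exact_left (LinearMap.ker f).subtype_injective f.exact_subtype_ker_map hf
      (h.of_flat _) hM) hn

end LocalFlat

section InjectiveDimension

variable {R : Type u} [CommRing R] {x y : R}

section

variable {K F M : Type u} [AddCommGroup K] [Module R K] [AddCommGroup F] [Module R F]
  [AddCommGroup M] [Module R M] {g : K →ₗ[R] F} {f : F →ₗ[R] M}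

lemma subsingleton_ext_of_exact (hg : Function.Injective g) (hgf : Function.Exact g f)
    (hf : Function.Surjective f) (N : ModuleCat.{u} R) (i : ℕ)
    (hK : Subsingleton (Abelian.Ext (ModuleCat.of R K) N i))
    (hM : Subsingleton (Abelian.Ext (ModuleCat.of R M) N i)) :
    Subsingleton (Abelian.Ext (ModuleCat.of R F) N i) := by
  have hS := shortExact_of_linearMap hg hgf hf
  refine subsingleton_of_forall_eq 0 fun e ↦ ?_
  obtain ⟨e', rfl⟩ := Abelian.Ext.contravariant_sequence_exact₂ hS _ e
    (Subsingleton.elim (α := Abelian.Ext (ModuleCat.of R K) N i) _ _)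
  have : e' = 0 := Subsingleton.elim (α := Abelian.Ext (ModuleCat.of R M) N i) _ _
  rw [this, Abelian.Ext.comp_zero]

lemma subsingleton_ext_succ_of_injective (hg : Function.Injective g) (hgf : Function.Exact g f)
    (hf : Function.Surjective f) (hF : Module.Injective R F) (N : ModuleCat.{u} R) (i : ℕ)
    (hM : Subsingleton (Abelian.Ext N (ModuleCat.of R M) i)) :
    Subsingleton (Abelian.Ext N (ModuleCat.of R K) (i + 1)) := by
  have hS := shortExact_of_linearMap hg hgf hf
  have : Injective (ModuleCat.of R F) := (Module.injective_iff_injective_object R F).1 hF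
  refine subsingleton_of_forall_eq 0 fun e ↦ ?_
  obtain ⟨e', rfl⟩ := Abelian.Ext.covariant_sequence_exact₁ _ hS e
    (Abelian.Ext.eq_zero_of_injective _) rfl
  have : e' = 0 := Subsingleton.elim (α := Abelian.Ext N (ModuleCat.of R M) i) _ _
  rw [this, Abelian.Ext.zero_comp]

lemma subsingleton_ext_of_succ_of_injective (hg : Function.Injective g)
    (hgf : Function.Exact g f) (hf : Function.Surjective f) (hF : Module.Injective R F)
    (N : ModuleCat.{u} R) (i : ℕ)
    (hK : Subsingleton (Abelian.Ext N (ModuleCat.of R K) (i + 2))) :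
    Subsingleton (Abelian.Ext N (ModuleCat.of R M) (i + 1)) := by
  have hS := shortExact_of_linearMap hg hgf hf
  have : Injective (ModuleCat.of R F) := (Module.injective_iff_injective_object R F).1 hF
  refine subsingleton_of_forall_eq 0 fun e ↦ ?_
  obtain ⟨e', rfl⟩ := Abelian.Ext.covariant_sequence_exact₃ _ hS e rfl
    (Subsingleton.elim (α := Abelian.Ext N (ModuleCat.of R K) (i + 2)) _ _)
  have : e' = 0 := Abelian.Ext.eq_zero_of_injective (I := ModuleCat.of R F) _
  rw [this, Abelian.Ext.zero_comp]

lemma subsingleton_ext_one_of_forall_lift (hg : Function.Injective g)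
    (hgf : Function.Exact g f) (hf : Function.Surjective f) (hF : Module.Injective R F)
    (N : Type u) [AddCommGroup N] [Module R N]
    (h : ∀ φ : N →ₗ[R] M, ∃ ψ : N →ₗ[R] F, f ∘ₗ ψ = φ) :
    Subsingleton (Abelian.Ext (ModuleCat.of R N) (ModuleCat.of R K) 1) := by
  have hS := shortExact_of_linearMap hg hgf hf
  have : Injective (ModuleCat.of R F) := (Module.injective_iff_injective_object R F).1 hF
  refine subsingleton_of_forall_eq 0 fun e ↦ ?_
  obtain ⟨e', rfl⟩ := Abelian.Ext.covariant_sequence_exact₁ _ hS e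
    (Abelian.Ext.eq_zero_of_injective _) (zero_add 1)
  obtain ⟨φ, rfl⟩ := Abelian.Ext.homEquiv₀.symm.surjective e'
  obtain ⟨ψ, hψ⟩ := h φ.hom
  have h₂ : φ = (ModuleCat.ofHom ψ) ≫ (ModuleCat.ofHom f) := ModuleCat.hom_ext hψ.symm
  have h₃ : (Abelian.Ext.mk₀ φ).comp hS.extClass (zero_add 1) = 0 := by
    rw [h₂, ← Abelian.Ext.mk₀_comp_mk₀]
    rw [Abelian.Ext.comp_assoc (a₂₃ := 1) _ _ _ (zero_add 0) (zero_add 1) (by lia)]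
    exact (congrArg (fun z ↦ (Abelian.Ext.mk₀ (ModuleCat.ofHom ψ)).comp z (zero_add 1))
      hS.comp_extClass).trans (Abelian.Ext.comp_zero _ _ _ _ _)
  exact h₃

end

/-- Baer's criterion for injective dimension. -/
lemma hasInjectiveDimensionLE_of_forall_ideal (n : ℕ) (M : Type u) [AddCommGroup M] [Module R M]
    (h : ∀ I : Ideal R,
      Subsingleton (Abelian.Ext (ModuleCat.of R (R ⧸ I)) (ModuleCat.of R M) (n + 1))) :
    HasInjectiveDimensionLE (ModuleCat.of R M) n := by
  induction n generalizing M with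
  | zero =>
    rw [hasInjectiveDimensionLE_zero_iff]
    refine Module.Baer.injective fun I φ ↦ ?_
    obtain ⟨ψ, hψ⟩ := exists_extension_of_subsingleton_ext_one I.subtype_injective
      (LinearMap.exact_subtype_mkQ I) (Submodule.mkQ_surjective I) M (h I) φ
    exact ⟨ψ, fun r hr ↦ LinearMap.congr_fun hψ ⟨r, hr⟩⟩
  | succ n ih =>
    obtain ⟨I, _, _, g, hI, hg⟩ := exists_injective_embedding (R := R) M
    rw [hasInjectiveDimensionLE_succ_iff hg g.exact_map_mkQ_range (Submodule.mkQ_surjective _) hI]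
    exact ih _ fun J ↦ subsingleton_ext_of_succ_of_injective hg g.exact_map_mkQ_range
      (Submodule.mkQ_surjective _) hI _ _ (h J)

lemma IsExactPairOn.subsingleton_ext_of_smul_eq_zero (h : IsExactPairOn R x y) (n : ℕ)
    (M N : Type u) [AddCommGroup M] [Module R M] [AddCommGroup N] [Module R N]
    (hM : IsExactPairOn M x y)
    (hn : HasInjectiveDimensionLE
      (ModuleCat.of (R ⧸ Ideal.span {x}) (Submodule.torsionBy R M x)) n)
    (hN : ∀ b : N, x • b = 0) :
    Subsingleton (Abelian.Ext (ModuleCat.of R N) (ModuleCat.of R M) (n + 1)) := by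
  induction n generalizing M with
  | zero =>
    rw [hasInjectiveDimensionLE_zero_iff] at hn
    obtain ⟨I, _, _, g, hI, hg⟩ := exists_injective_embedding (R := R) M
    have hC : IsExactPairOn (I ⧸ LinearMap.range g) x y :=
      .of_exact_right hg g.exact_map_mkQ_range (Submodule.mkQ_surjective _) hM
        (h.of_injective I hI)
    have hsurj := hC.torsionByMap_surjective (Submodule.mkQ_surjective (LinearMap.range g))
    obtain ⟨r, hr⟩ := hn.out (torsionByMap x g) (torsionByMap_injective x hg) LinearMap.id
    have hsplit := (torsionByMap_exact x hg g.exact_map_mkQ_range).split_tfae'.out 1 0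
    obtain ⟨-, s, hs⟩ := hsplit.1 ⟨hsurj, r, LinearMap.ext hr⟩
    refine subsingleton_ext_one_of_forall_lift hg g.exact_map_mkQ_range
      (Submodule.mkQ_surjective _) hI N fun φ ↦ ?_
    refine ⟨(Submodule.torsionBy R I x).subtype ∘ₗ s.restrictScalars R ∘ₗ
      φ.codRestrict (Submodule.torsionBy R _ x) (fun b ↦ ?_), ?_⟩
    · rw [Submodule.mem_torsionBy_iff, ← map_smul, hN, map_zero]
    · ext b
      exact congrArg Subtype.val (LinearMap.congr_fun hs _)
  | succ n ih =>
    obtain ⟨I, _, _, g, hI, hg⟩ := exists_injective_embedding (R := R) M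
    have hC : IsExactPairOn (I ⧸ LinearMap.range g) x y :=
      .of_exact_right hg g.exact_map_mkQ_range (Submodule.mkQ_surjective _) hM
        (h.of_injective I hI)
    refine subsingleton_ext_succ_of_injective hg g.exact_map_mkQ_range
      (Submodule.mkQ_surjective _) hI _ _ (ih _ hC ?_)
    exact (hasInjectiveDimensionLE_succ_iff (torsionByMap_injective x hg)
      (torsionByMap_exact x hg g.exact_map_mkQ_range)
      (hC.torsionByMap_surjective (Submodule.mkQ_surjective _))
      (injective_torsionBy x I hI) n).1 hn

variable [IsLocalRing R] [IsNoetherianRing R]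

lemma subsingleton_ext_of_smul_injective (hx : ¬ IsUnit x) (n : ℕ) (M N : Type u)
    [AddCommGroup M] [Module R M] [Module.Finite R M] [AddCommGroup N] [Module R N]
    [Module.Finite R N] (hM : HasInjectiveDimensionLE (ModuleCat.of R M) n)
    (hN : Function.Injective (LinearMap.lsmul R N x)) :
    Subsingleton (Abelian.Ext (ModuleCat.of R N) (ModuleCat.of R M) n) := by
  have hS := shortExact_of_linearMap hN (LinearMap.lsmul R N x).exact_map_mkQ_range
    (Submodule.mkQ_surjective _)
  have hx' : ModuleCat.ofHom (LinearMap.lsmul R N x) = x • 𝟙 (ModuleCat.of R N) :=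
    ModuleCat.hom_ext (by ext; rfl)
  have hbot : (⊤ : Submodule R (Abelian.Ext (ModuleCat.of R N) (ModuleCat.of R M) n)) = ⊥ := by
    refine eq_bot_of_forall_exists_smul_eq (IsNoetherian.noetherian _) hx ?_
    rintro ⟨e, -⟩
    obtain ⟨e', he'⟩ := Abelian.Ext.contravariant_sequence_exact₁ hS _ e (add_comm 1 n)
      ((hasInjectiveDimensionLT_iff _ _).1 hM (n + 1) le_rfl _)
    refine ⟨⟨e', trivial⟩, Subtype.ext (Eq.trans ?_ he')⟩
    change x • e' = (Abelian.Ext.mk₀ (ModuleCat.ofHom (LinearMap.lsmul R N x))).comp e' _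
    rw [hx', Abelian.Ext.mk₀_smul, Abelian.Ext.smul_comp, Abelian.Ext.mk₀_id_comp]
  exact subsingleton_of_forall_eq 0 fun e ↦ by
    rw [← Submodule.mem_bot R, ← hbot]; trivial

lemma IsExactPairOn.hasInjectiveDimensionLE_of_succ (h : IsExactPairOn R x y) (hx : ¬ IsUnit x)
    (n : ℕ) (M : Type u) [AddCommGroup M] [Module R M] [Module.Finite R M]
    (hM : HasInjectiveDimensionLE (ModuleCat.of R M) (n + 1))
    (hn : HasInjectiveDimensionLE
      (ModuleCat.of (R ⧸ Ideal.span {x}) (Submodule.torsionBy R M x)) n) :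
    HasInjectiveDimensionLE (ModuleCat.of R M) n := by
  have hEM := h.of_hasInjectiveDimensionLE _ _ hM
  refine hasInjectiveDimensionLE_of_forall_ideal n M fun I ↦ ?_
  refine IsNoetherianRing.induction_on_isQuotientEquivQuotientPrime R (M := R ⧸ I) inferInstance
    (motive := fun N _ _ _ ↦
      Subsingleton (Abelian.Ext (ModuleCat.of R N) (ModuleCat.of R M) (n + 1))) ?_ ?_ ?_
  · intro N _ _ _ _
    exact h.subsingleton_ext_of_smul_eq_zero n M N hEM hn fun b ↦ Subsingleton.elim _ _
  · intro N _ _ _ p a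
    by_cases hp : x ∈ p.asIdeal
    · refine h.subsingleton_ext_of_smul_eq_zero n M N hEM hn fun b ↦ a.injective ?_
      obtain ⟨r, hr⟩ := Ideal.Quotient.mk_surjective (a b)
      rw [map_smul, ← hr, map_zero, Algebra.smul_def, Ideal.Quotient.algebraMap_eq,
        Ideal.Quotient.eq_zero_iff_mem.2 hp, zero_mul]
    · refine subsingleton_ext_of_smul_injective hx (n + 1) M N hM ?_
      rw [injective_iff_map_eq_zero]
      intro b hb
      have : Ideal.Quotient.mk p.asIdeal x * a b = 0 := by
        rw [← Ideal.Quotient.algebraMap_eq, ← Algebra.smul_def, ← map_smul]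
        exact (congrArg a hb).trans a.map_zero
      have h' := (_root_.mul_eq_zero.1 this).resolve_left
        (by rwa [Ideal.Quotient.eq_zero_iff_mem])
      exact (LinearEquiv.map_eq_zero_iff a).1 h'
  · intro N₁ _ _ _ N₂ _ _ _ N₃ _ _ _ f g hf hg hfg h₁ h₃
    exact subsingleton_ext_of_exact hf hfg hg _ _ h₁ h₃

lemma IsExactPairOn.hasInjectiveDimensionLE_of_torsionBy (h : IsExactPairOn R x y)
    (hx : ¬ IsUnit x) (n d : ℕ) (M : Type u) [AddCommGroup M] [Module R M] [Module.Finite R M]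
    (hM : HasInjectiveDimensionLE (ModuleCat.of R M) d)
    (hn : HasInjectiveDimensionLE
      (ModuleCat.of (R ⧸ Ideal.span {x}) (Submodule.torsionBy R M x)) n) :
    HasInjectiveDimensionLE (ModuleCat.of R M) n := by
  have key (k : ℕ) (hk : HasInjectiveDimensionLE (ModuleCat.of R M) (n + k)) :
      HasInjectiveDimensionLE (ModuleCat.of R M) n := by
    induction k with
    | zero => exact hk
    | succ k ih =>
      exact ih (h.hasInjectiveDimensionLE_of_succ hx (n + k) M hk
        (hasInjectiveDimensionLT_of_ge _ (n + 1) (n + k + 1) (by lia)))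
  exact key d (hasInjectiveDimensionLT_of_ge _ (d + 1) (n + d + 1) (by lia))

end InjectiveDimension

end

/-- Let `(x, y)` be a pair of exact zero-divisors on `R`, `M` an `R`-module with
`M ≠ xM` and `x ∉ (0 :_R M)`, and `R̄ = R/(x)`, `M̄ = M/xM`.  If at least one of
`id_R M`, `pd_R M`, `fd_R M` is finite, then:
(a) `(x, y)` is a pair of exact zero-divisors on `M`;
(b) `id_R̄ M̄ ≤ id_R M`, `pd_R̄ M̄ ≤ pd_R M`, and `fd_R̄ M̄ ≤ fd_R M`;
(c) if `R` is local and `M` finitely generated, each inequality in (b) whose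
right-hand side is finite is an equality. -/
theorem isEZDPair_of_finite_homological_dim
    (R : Type u) [CommRing R] [IsNoetherianRing R] (x y : R)
    (hxy : IsEZDPair R R x y)
    (M : Type u) [AddCommGroup M] [Module R M]
    (hM1 : Ideal.span {x} • (⊤ : Submodule R M) ≠ ⊤) (hM2 : ∃ m : M, x • m ≠ 0)
    (hfin : injDim R (ModuleCat.of R M) ≠ ⊤ ∨ projDim R (ModuleCat.of R M) ≠ ⊤ ∨
      flatDim R (ModuleCat.of R M) ≠ ⊤) :
    IsEZDPair R M x y ∧
    (injDim (R ⧸ Ideal.span {x})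
        (ModuleCat.of _ (M ⧸ (Ideal.span {x} • (⊤ : Submodule R M)))) ≤
      injDim R (ModuleCat.of R M) ∧
     projDim (R ⧸ Ideal.span {x})
        (ModuleCat.of _ (M ⧸ (Ideal.span {x} • (⊤ : Submodule R M)))) ≤
      projDim R (ModuleCat.of R M) ∧
     flatDim (R ⧸ Ideal.span {x})
        (ModuleCat.of _ (M ⧸ (Ideal.span {x} • (⊤ : Submodule R M)))) ≤
      flatDim R (ModuleCat.of R M)) ∧
    (∀ (_ : IsLocalRing R) (_ : Module.Finite R M),
      (injDim R (ModuleCat.of R M) ≠ ⊤ →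
        injDim (R ⧸ Ideal.span {x})
          (ModuleCat.of _ (M ⧸ (Ideal.span {x} • (⊤ : Submodule R M)))) =
        injDim R (ModuleCat.of R M)) ∧
      (projDim R (ModuleCat.of R M) ≠ ⊤ →
        projDim (R ⧸ Ideal.span {x})
          (ModuleCat.of _ (M ⧸ (Ideal.span {x} • (⊤ : Submodule R M)))) =
        projDim R (ModuleCat.of R M)) ∧
      (flatDim R (ModuleCat.of R M) ≠ ⊤ →
        flatDim (R ⧸ Ideal.span {x})
          (ModuleCat.of _ (M ⧸ (Ideal.span {x} • (⊤ : Submodule R M)))) =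
        flatDim R (ModuleCat.of R M))) := by
  have hxy0 := hxy.mul_eq_zero
  have h : IsExactPairOn R x y := (isEZDPair_iff hxy0 hxy.1 hxy.2.1).1 hxy
  have hx : ¬ IsUnit x := fun hu ↦ hxy.1 (by
    rw [Ideal.span_singleton_eq_top.2 hu, Submodule.top_smul])
  have hEM : IsExactPairOn M x y := by
    rcases hfin with hd | hd | hd
    · obtain ⟨n, hn⟩ := ENat.ne_top_iff_exists.1 hd
      exact h.of_hasInjectiveDimensionLE n M ((injDim_le_iff _ n).1 hn.ge)
    · obtain ⟨n, hn⟩ := ENat.ne_top_iff_exists.1 hd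
      exact h.of_hasFlatDimensionLE n M
        (hasFlatDimensionLE_of_hasProjectiveDimensionLE ((projDim_le_iff _ n).1 hn.ge))
    · obtain ⟨n, hn⟩ := ENat.ne_top_iff_exists.1 hd
      exact h.of_hasFlatDimensionLE n M ((flatDim_le_iff _ n).1 hn.ge)
  have le_of_forall {a b : ℕ∞} (hab : ∀ n : ℕ, b ≤ n → a ≤ n) : a ≤ b := by
    induction b using ENat.recTopCoe with
    | top => exact le_top
    | coe n => exact hab n le_rfl
  have injDim_le := le_of_forall (a := injDim (R ⧸ Ideal.span {x})
      (ModuleCat.of _ (M ⧸ (Ideal.span {x} • (⊤ : Submodule R M)))))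
      (b := injDim R (ModuleCat.of R M)) fun n hn ↦ by
    rw [injDim_le_iff] at hn ⊢
    have := h.hasInjectiveDimensionLE_torsionBy n M hn
    exact (ModuleCat.hasInjectiveDimensionLE_iff_of_linearEquiv hEM.quotientEquivTorsionBy n).2 this
  have projDim_le := le_of_forall (a := projDim (R ⧸ Ideal.span {x})
      (ModuleCat.of _ (M ⧸ (Ideal.span {x} • (⊤ : Submodule R M)))))
      (b := projDim R (ModuleCat.of R M)) fun n hn ↦ by
    rw [projDim_le_iff] at hn ⊢
    have := h.hasProjectiveDimensionLE_baseChange n M hn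
    exact ModuleCat.hasProjectiveDimensionLE_of_linearEquiv
      (M := ModuleCat.of _ (TensorProduct R (R ⧸ Ideal.span {x}) M)) (baseChangeEquivQuotient x M) n
  have flatDim_le := le_of_forall (a := flatDim (R ⧸ Ideal.span {x})
      (ModuleCat.of _ (M ⧸ (Ideal.span {x} • (⊤ : Submodule R M)))))
      (b := flatDim R (ModuleCat.of R M)) fun n hn ↦ by
    rw [flatDim_le_iff] at hn ⊢
    exact (h.hasFlatDimensionLE_baseChange n M hn).of_linearEquiv (baseChangeEquivQuotient x M)
  refine ⟨(isEZDPair_iff hxy0 hM1 hM2).2 hEM, ⟨injDim_le, projDim_le, flatDim_le⟩,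
    fun _ _ ↦ ⟨fun hd ↦ injDim_le.antisymm (le_of_forall fun n hn ↦ ?_),
      fun _ ↦ projDim_le.antisymm (le_of_forall fun n hn ↦ ?_),
      fun _ ↦ flatDim_le.antisymm (le_of_forall fun n hn ↦ ?_)⟩⟩
  · obtain ⟨d, hd⟩ := ENat.ne_top_iff_exists.1 hd
    rw [injDim_le_iff] at hn ⊢
    refine h.hasInjectiveDimensionLE_of_torsionBy hx n d M ((injDim_le_iff _ d).1 hd.ge) ?_
    exact (ModuleCat.hasInjectiveDimensionLE_iff_of_linearEquiv hEM.quotientEquivTorsionBy n).1 hn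
  · rw [projDim_le_iff] at hn ⊢
    exact h.hasProjectiveDimensionLE_of_baseChange hx n M hEM
      ((hasFlatDimensionLE_of_hasProjectiveDimensionLE hn).of_linearEquiv
        (baseChangeEquivQuotient x M).symm)
  · rw [flatDim_le_iff] at hn ⊢
    exact hasFlatDimensionLE_of_hasProjectiveDimensionLE
      (h.hasProjectiveDimensionLE_of_baseChange hx n M hEM
        (hn.of_linearEquiv (baseChangeEquivQuotient x M).symm))
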